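/- (Lemma on the subvariety 𝒲, part 2) For every fixed (a,b) ∈ F^n × F^{n+1}, the map u ↦ p′(u·σ′(a,b)) is a bijection from N_{n,−} onto 𝒱′, and the map u ↦ p(u·σ′(a,b)) from N_{n,−} to 𝒱 is injective. -/

import Mathlib

open Matrix MeasureTheory

namespace ZhangRTF

variable {F : Type*} [Field F] {n : ℕ}

/-- Block diagonal embedding `diag(h,1) ∈ M_{n+1}(F)` of `h ∈ M_n(F)`. -/
def emb (h : Matrix (Fin n) (Fin n) F) : Matrix (Fin (n + 1)) (Fin (n + 1)) F :=
  Matrix.of fun i j =>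
    if hi : (i : ℕ) < n then
      (if hj : (j : ℕ) < n then h ⟨i, hi⟩ ⟨j, hj⟩ else 0)
    else (if (j : ℕ) < n then 0 else 1)

/-- Conjugation action of `GL_n(F)` on `M_{n+1}(F)`: `h·X = diag(h,1) X diag(h,1)⁻¹`. -/
def act (h : Matrix.GeneralLinearGroup (Fin n) F)
    (X : Matrix (Fin (n + 1)) (Fin (n + 1)) F) : Matrix (Fin (n + 1)) (Fin (n + 1)) F :=
  emb (h : Matrix (Fin n) (Fin n) F) * X *
    emb ((h⁻¹ : Matrix.GeneralLinearGroup (Fin n) F) : Matrix (Fin n) (Fin n) F)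

/-- The upper-left `n × n` block `A` of `X = [[A,u],[v,w]]`. -/
def blockA (X : Matrix (Fin (n + 1)) (Fin (n + 1)) F) : Matrix (Fin n) (Fin n) F :=
  Matrix.of fun i j => X i.castSucc j.castSucc

/-- The upper-right column `u` of `X = [[A,u],[v,w]]`. -/
def blockU (X : Matrix (Fin (n + 1)) (Fin (n + 1)) F) : Fin n → F :=
  fun i => X i.castSucc (Fin.last n)

/-- The lower-left row `v` of `X = [[A,u],[v,w]]`. -/
def blockV (X : Matrix (Fin (n + 1)) (Fin (n + 1)) F) : Fin n → F :=
  fun j => X (Fin.last n) j.castSucc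

/-- The lower-right corner `w` of `X = [[A,u],[v,w]]`. -/
def blockW (X : Matrix (Fin (n + 1)) (Fin (n + 1)) F) : F :=
  X (Fin.last n) (Fin.last n)

/-- `δ₊(X)`: the matrix whose `j`-th column is `A^{n-j} u` (`1 ≤ j ≤ n`, 1-indexed). -/
def deltaPlus (X : Matrix (Fin (n + 1)) (Fin (n + 1)) F) : Matrix (Fin n) (Fin n) F :=
  Matrix.of fun i j => (blockA X ^ (n - 1 - (j : ℕ)) *ᵥ blockU X) i

/-- `δ₋(X)`: the matrix whose `i`-th row is `v A^{i-1}` (`1 ≤ i ≤ n`, 1-indexed). -/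
def deltaMinus (X : Matrix (Fin (n + 1)) (Fin (n + 1)) F) : Matrix (Fin n) (Fin n) F :=
  Matrix.of fun i j => (blockV X ᵥ* blockA X ^ (i : ℕ)) j

/-- `Δ₊(X) = det δ₊(X)`. -/
def DeltaPlus (X : Matrix (Fin (n + 1)) (Fin (n + 1)) F) : F := (deltaPlus X).det

/-- `Δ₋(X) = det δ₋(X)`. -/
def DeltaMinus (X : Matrix (Fin (n + 1)) (Fin (n + 1)) F) : F := (deltaMinus X).det

/-- The `a`-invariants: `a_i = -(coefficient of T^{n-i} in charpoly A)` (1-indexed). -/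
noncomputable def aInv (X : Matrix (Fin (n + 1)) (Fin (n + 1)) F) : Fin n → F :=
  fun i => -((blockA X).charpoly.coeff (n - 1 - (i : ℕ)))

/-- The `b`-invariants: `b_0 = w` and `b_j = v A^{j-1} u` for `1 ≤ j ≤ n`. -/
def bInv (X : Matrix (Fin (n + 1)) (Fin (n + 1)) F) : Fin (n + 1) → F :=
  fun j => if (j : ℕ) = 0 then blockW X
    else blockV X ⬝ᵥ (blockA X ^ ((j : ℕ) - 1) *ᵥ blockU X)

/-- The invariants map `π : M_{n+1}(F) → F^n × F^{n+1}`. -/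
noncomputable def invMap (X : Matrix (Fin (n + 1)) (Fin (n + 1)) F) : (Fin n → F) × (Fin (n + 1) → F) :=
  (aInv X, bInv X)

/-- The regular nilpotent `ξ₊`: `(i,i+1)`-entries equal to `1`, all others `0`. -/
def xiPlus (n : ℕ) : Matrix (Fin (n + 1)) (Fin (n + 1)) F :=
  Matrix.of fun i j => if (j : ℕ) = (i : ℕ) + 1 then 1 else 0

/-- The section `σ(a,b)` of the invariants map. -/
def sectSigma (a : Fin n → F) (b : Fin (n + 1) → F) : Matrix (Fin (n + 1)) (Fin (n + 1)) F :=
  Matrix.of fun i j =>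
    if hi : (i : ℕ) < n then
      (if (j : ℕ) = 0 then a ⟨i, hi⟩ else 0) + (if (j : ℕ) = (i : ℕ) + 1 then 1 else 0)
    else b j.rev

/-- The variant section `σ'(a,b)`. -/
def sectSigma' (a : Fin n → F) (b : Fin (n + 1) → F) : Matrix (Fin (n + 1)) (Fin (n + 1)) F :=
  Matrix.of fun i j =>
    if (i : ℕ) < n - 1 then (if (j : ℕ) = (i : ℕ) + 1 then 1 else 0)
    else if (i : ℕ) = n - 1 then
      (if hj : (j : ℕ) < n then a ⟨n - 1 - (j : ℕ), by omega⟩ else 1)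
    else b j.rev

/-- Membership in `N_{n,-}`: lower triangular with unit diagonal. -/
def IsLowerUni (h : Matrix (Fin n) (Fin n) F) : Prop :=
  (∀ i, h i i = 1) ∧ ∀ i j : Fin n, i < j → h i j = 0

/-- Membership in `N_n`: upper triangular with unit diagonal. -/
def IsUpperUni (h : Matrix (Fin n) (Fin n) F) : Prop :=
  (∀ i, h i i = 1) ∧ ∀ i j : Fin n, j < i → h i j = 0

/-- Membership in the subvariety `𝒲`: superdiagonal entries `1`,
entries above the superdiagonal `0`. -/
def memW (X : Matrix (Fin (n + 1)) (Fin (n + 1)) F) : Prop :=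
  ∀ i j : Fin (n + 1),
    ((j : ℕ) = (i : ℕ) + 1 → X i j = 1) ∧ ((i : ℕ) + 1 < (j : ℕ) → X i j = 0)

/-- `p : 𝒲 → 𝒱`, replacing the last row by zero. -/
def pMap (X : Matrix (Fin (n + 1)) (Fin (n + 1)) F) : Matrix (Fin (n + 1)) (Fin (n + 1)) F :=
  Matrix.of fun i j => if (i : ℕ) = n then 0 else X i j

/-- `p' : 𝒲 → 𝒱'`, replacing the last row and the first column by zero. -/
def pMap' (X : Matrix (Fin (n + 1)) (Fin (n + 1)) F) : Matrix (Fin (n + 1)) (Fin (n + 1)) F :=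
  Matrix.of fun i j => if (i : ℕ) = n ∨ (j : ℕ) = 0 then 0 else X i j

/-- The determinant of an element of `GL_n(F)`, as a unit of `F`. -/
def GLdet (h : Matrix.GeneralLinearGroup (Fin n) F) : Fˣ :=
  Units.map Matrix.detMonoidHom h

end ZhangRTF

open ZhangRTF


section helpers
variable {F : Type*} [Field F] {n : ℕ}

lemma emb_cc (h : Matrix (Fin n) (Fin n) F) (i j : Fin n) :
    emb h i.castSucc j.castSucc = h i j := by simp [emb]
lemma emb_cl (h : Matrix (Fin n) (Fin n) F) (i : Fin n) :
    emb h i.castSucc (Fin.last n) = 0 := by simp [emb]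
lemma emb_lc (h : Matrix (Fin n) (Fin n) F) (j : Fin n) :
    emb h (Fin.last n) j.castSucc = 0 := by simp [emb]
lemma emb_ll (h : Matrix (Fin n) (Fin n) F) :
    emb h (Fin.last n) (Fin.last n) = 1 := by simp [emb]

lemma emb_mul (g h : Matrix (Fin n) (Fin n) F) : emb g * emb h = emb (g * h) := by
  ext i j
  rw [Matrix.mul_apply, Fin.sum_univ_castSucc]
  refine Fin.lastCases ?_ (fun i => ?_) i <;> refine Fin.lastCases ?_ (fun j => ?_) j <;>
    simp [emb_cc, emb_cl, emb_lc, emb_ll, Matrix.mul_apply]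

lemma emb_one : emb (1 : Matrix (Fin n) (Fin n) F) = 1 := by
  ext i j
  refine Fin.lastCases ?_ (fun i => ?_) i <;> refine Fin.lastCases ?_ (fun j => ?_) j <;>
    simp [emb_cc, emb_cl, emb_lc, emb_ll, Matrix.one_apply, Fin.ext_iff]
  · intro h; have := j.2; omega
  · intro h; have := i.2; omega

lemma emb_lower {h : Matrix (Fin n) (Fin n) F} (hh : IsLowerUni h) : IsLowerUni (emb h) := by
  constructor
  · intro i
    refine Fin.lastCases ?_ (fun i => ?_) i
    · exact emb_ll h
    · rw [emb_cc]; exact hh.1 i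
  · intro i j
    refine Fin.lastCases ?_ (fun i => ?_) i <;> refine Fin.lastCases ?_ (fun j => ?_) j
    · intro h; exact absurd h (lt_irrefl _)
    · intro _; exact emb_lc h j
    · intro _; exact emb_cl h i
    · intro hij; rw [emb_cc]; exact hh.2 i j (by simpa using hij)

lemma inv_lower {u : Matrix.GeneralLinearGroup (Fin n) F}
    (hu : IsLowerUni (u : Matrix (Fin n) (Fin n) F)) :
    IsLowerUni ((u⁻¹ : Matrix.GeneralLinearGroup (Fin n) F) : Matrix (Fin n) (Fin n) F) := by
  have h0 : ∀ i j : Fin n, i < j →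
      ((u⁻¹ : Matrix.GeneralLinearGroup (Fin n) F) : Matrix (Fin n) (Fin n) F) i j = 0 := by
    have hb : Matrix.BlockTriangular (u : Matrix (Fin n) (Fin n) F) OrderDual.toDual :=
      fun i j hij => hu.2 i j hij
    haveI : Invertible (u : Matrix (Fin n) (Fin n) F) := u.invertible
    have := Matrix.blockTriangular_inv_of_blockTriangular hb
    intro i j hij
    rw [Matrix.coe_units_inv]
    exact this hij
  refine ⟨fun i => ?_, h0⟩
  have h1 : (u : Matrix (Fin n) (Fin n) F) *
      ((u⁻¹ : Matrix.GeneralLinearGroup (Fin n) F) : Matrix (Fin n) (Fin n) F) = 1 := by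
    rw [← Units.val_mul]; simp
  have h2 := congrFun (congrFun h1 i) i
  rw [Matrix.mul_apply, Finset.sum_eq_single i, hu.1 i, one_mul, Matrix.one_apply_eq] at h2
  · exact h2
  · intro k _ hk
    rcases lt_or_gt_of_ne hk with h | h
    · rw [h0 k i h, mul_zero]
    · rw [hu.2 i k h, zero_mul]
  · simp

lemma memW_mul_left {L M : Matrix (Fin (n + 1)) (Fin (n + 1)) F} (hL : IsLowerUni L)
    (hM : memW M) : memW (L * M) := by
  intro i j
  constructor
  · intro hij
    rw [Matrix.mul_apply, Finset.sum_eq_single i, hL.1 i, one_mul, (hM i j).1 hij]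
    · intro k _ hk
      rcases lt_or_gt_of_ne hk with h | h
      · rw [(hM k j).2 (by have : (k : ℕ) < i := h
                           omega), mul_zero]
      · rw [hL.2 i k h, zero_mul]
    · simp
  · intro hij
    rw [Matrix.mul_apply]
    refine Finset.sum_eq_zero fun k _ => ?_
    rcases lt_or_ge i k with h | h
    · rw [hL.2 i k h, zero_mul]
    · rw [(hM k j).2 (by have : (k : ℕ) ≤ i := h
                         omega), mul_zero]

lemma memW_mul_right {L M : Matrix (Fin (n + 1)) (Fin (n + 1)) F} (hL : IsLowerUni L)
    (hM : memW M) : memW (M * L) := by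
  intro i j
  constructor
  · intro hij
    rw [Matrix.mul_apply, Finset.sum_eq_single j, hL.1 j, mul_one, (hM i j).1 hij]
    · intro k _ hk
      rcases lt_or_gt_of_ne hk with h | h
      · rw [hL.2 k j h, mul_zero]
      · rw [(hM i k).2 (by have : (j : ℕ) < k := h
                           omega), zero_mul]
    · simp
  · intro hij
    rw [Matrix.mul_apply]
    refine Finset.sum_eq_zero fun k _ => ?_
    rcases lt_or_ge k j with h | h
    · rw [hL.2 k j h, mul_zero]
    · rw [(hM i k).2 (by have : (j : ℕ) ≤ k := h
                         omega), zero_mul]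

lemma memW_sigma (hn : 1 ≤ n) (a : Fin n → F) (b : Fin (n + 1) → F) :
    memW (sectSigma' a b) := by
  intro i j
  have := j.2
  constructor
  · intro hij
    simp only [sectSigma', Matrix.of_apply]
    split_ifs <;> first | rfl | omega
  · intro hij
    simp only [sectSigma', Matrix.of_apply]
    split_ifs <;> first | rfl | omega

lemma memW_act (hn : 1 ≤ n) (a : Fin n → F) (b : Fin (n + 1) → F)
    {u : Matrix.GeneralLinearGroup (Fin n) F}
    (hu : IsLowerUni (u : Matrix (Fin n) (Fin n) F)) : memW (act u (sectSigma' a b)) :=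
  memW_mul_right (emb_lower (inv_lower hu)) (memW_mul_left (emb_lower hu) (memW_sigma hn a b))

lemma act_mul_emb (u : Matrix.GeneralLinearGroup (Fin n) F)
    (X : Matrix (Fin (n + 1)) (Fin (n + 1)) F) :
    act u X * emb (u : Matrix (Fin n) (Fin n) F) = emb (u : Matrix (Fin n) (Fin n) F) * X := by
  rw [act, Matrix.mul_assoc, emb_mul, ← Units.val_mul]
  simp [emb_one]

/-- The correction term in the column recursion. -/
def corr (a : Fin n → F) (i j : Fin (n + 1)) : F :=
  if hj : (j : ℕ) < n then (if (i : ℕ) = n - 1 then a ⟨n - 1 - (j : ℕ), by omega⟩ else 0) else 0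

/-- Entries of `U σ'` off the last row and first column. -/
lemma mul_sigma (hn : 1 ≤ n) (a : Fin n → F) (b : Fin (n + 1) → F)
    {u : Matrix (Fin n) (Fin n) F} (hu : IsLowerUni u) (i j j' : Fin (n + 1)) (hi : (i : ℕ) < n)
    (hj : (j : ℕ) = (j' : ℕ) + 1) :
    (emb u * sectSigma' a b) i j = emb u i j' + corr a i j := by
  have hU := emb_lower hu
  have hU1 : ∀ k : Fin (n + 1), (k : ℕ) = n - 1 → emb u i k = if (i : ℕ) = n - 1 then 1 else 0 := by
    intro k hk
    split_ifs with h
    · have : i = k := Fin.ext (by omega)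
      rw [this]; exact hU.1 k
    · exact hU.2 i k (by show (i : ℕ) < k
                         omega)
  have hU2 : ∀ k : Fin (n + 1), (k : ℕ) = n → emb u i k = 0 := fun k hk =>
    hU.2 i k (by show (i : ℕ) < k
                 omega)
  have key : ∀ k, emb u i k * sectSigma' a b k j =
      (if k = j' then emb u i j' else 0) +
      (if k = (⟨n - 1, by omega⟩ : Fin (n + 1)) then corr a i j else 0) := by
    intro k
    have hk := k.2
    have hjlt := j.2
    rcases lt_trichotomy (k : ℕ) (n - 1) with h | h | h
    · have h2 : k ≠ (⟨n - 1, by omega⟩ : Fin (n + 1)) := by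
        intro h'; rw [h'] at h; simp at h
      rw [if_neg h2]
      simp only [sectSigma', Matrix.of_apply, if_pos h]
      by_cases hkj : k = j'
      · subst hkj; simp [hj]
      · have : ¬ ((j : ℕ) = k + 1) := fun h' => hkj (Fin.ext (by omega))
        simp [hkj, this]
    · have h2 : k = (⟨n - 1, by omega⟩ : Fin (n + 1)) := Fin.ext h
      rw [if_pos h2, hU1 k h]
      simp only [sectSigma', Matrix.of_apply, if_neg (show ¬ ((k : ℕ) < n - 1) by omega), if_pos h,
        corr]
      by_cases hjn : (j : ℕ) < n
      · have : k ≠ j' := by rintro rfl; omega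
        simp [hjn, this]
      · have : k = j' := Fin.ext (by omega)
        rw [if_pos this, dif_neg hjn, dif_neg hjn, ← this, hU1 k h]
        simp
    · have h2 : k ≠ (⟨n - 1, by omega⟩ : Fin (n + 1)) := by
        intro h'; rw [h'] at h; simp at h
      have h3 : k ≠ j' := by rintro rfl; omega
      rw [if_neg h2, if_neg h3, hU2 k (by omega)]
      simp
  rw [Matrix.mul_apply, Finset.sum_congr rfl (fun k _ => key k), Finset.sum_add_distrib]
  simp

lemma pMap'_mul {u : Matrix (Fin n) (Fin n) F} (hu : IsLowerUni u)
    (Y : Matrix (Fin (n + 1)) (Fin (n + 1)) F) (i j : Fin (n + 1)) (hi : (i : ℕ) < n)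
    (hj : 1 ≤ (j : ℕ)) : (pMap' Y * emb u) i j = (Y * emb u) i j := by
  rw [Matrix.mul_apply, Matrix.mul_apply]
  refine Finset.sum_congr rfl fun k _ => ?_
  by_cases hk : (k : ℕ) = 0
  · rw [(emb_lower hu).2 k j (by show (k : ℕ) < j
                                 omega), mul_zero, mul_zero]
  · simp only [pMap', Matrix.of_apply]
    rw [if_neg (by omega)]

/-- The recursion satisfied by the columns of `U`. -/
lemma rec_col (hn : 1 ≤ n) (a : Fin n → F) (b : Fin (n + 1) → F)
    {u : Matrix.GeneralLinearGroup (Fin n) F}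
    (hu : IsLowerUni (u : Matrix (Fin n) (Fin n) F)) (i j j' : Fin (n + 1)) (hi : (i : ℕ) < n)
    (hj : (j : ℕ) = (j' : ℕ) + 1) :
    (pMap' (act u (sectSigma' a b)) * emb (u : Matrix (Fin n) (Fin n) F)) i j =
      emb (u : Matrix (Fin n) (Fin n) F) i j' + corr a i j := by
  rw [pMap'_mul hu _ i j hi (by omega), act_mul_emb, mul_sigma hn a b hu i j j' hi hj]

lemma emb_injective : Function.Injective (emb : Matrix (Fin n) (Fin n) F → _) := by
  intro g h hgh
  ext i j
  rw [← emb_cc g, ← emb_cc h, hgh]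

lemma injOn' (hn : 1 ≤ n) (a : Fin n → F) (b : Fin (n + 1) → F) :
    Set.InjOn (fun u : Matrix.GeneralLinearGroup (Fin n) F => pMap' (act u (sectSigma' a b)))
      {u : Matrix.GeneralLinearGroup (Fin n) F | IsLowerUni (u : Matrix (Fin n) (Fin n) F)} := by
  intro u hu v hv huv
  simp only [Set.mem_setOf_eq] at hu hv huv
  apply Units.ext
  apply emb_injective
  have key : ∀ k : ℕ, ∀ j : Fin (n + 1), (j : ℕ) + k = n → ∀ i,
      emb (u : Matrix (Fin n) (Fin n) F) i j = emb (v : Matrix (Fin n) (Fin n) F) i j := by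
    intro k
    induction k with
    | zero =>
      intro j hj i
      have : j = Fin.last n := Fin.ext (by simpa using hj)
      subst this
      refine Fin.lastCases ?_ (fun i => ?_) i
      · rw [emb_ll, emb_ll]
      · rw [emb_cl, emb_cl]
    | succ k ih =>
      intro j hj i
      rcases lt_or_ge (i : ℕ) n with hi | hi
      · have h1 := rec_col hn a b hu i ⟨j + 1, by omega⟩ j hi rfl
        have h2 := rec_col hn a b hv i ⟨j + 1, by omega⟩ j hi rfl
        rw [huv] at h1
        have h3 : (pMap' (act v (sectSigma' a b)) * emb (u : Matrix (Fin n) (Fin n) F)) i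
            ⟨j + 1, by omega⟩ = (pMap' (act v (sectSigma' a b)) *
              emb (v : Matrix (Fin n) (Fin n) F)) i ⟨j + 1, by omega⟩ := by
          rw [Matrix.mul_apply, Matrix.mul_apply]
          exact Finset.sum_congr rfl fun l _ => by rw [ih ⟨j + 1, by omega⟩ (by simp; omega) l]
        rw [h1, h2] at h3
        exact add_right_cancel h3
      · have h1 : i = Fin.last n := Fin.ext (by have := i.2; simp; omega)
        have h2 : j = (⟨j, by omega⟩ : Fin n).castSucc := rfl
        rw [h1, h2, emb_lc, emb_lc]
  ext i j
  exact key (n - j) j (by have := j.2; omega) i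

/-- The columns of the solution, from right to left. -/
def cols (a : Fin n → F) (Z : Matrix (Fin (n + 1)) (Fin (n + 1)) F) : ℕ → Fin (n + 1) → F
  | 0 => fun i => if (i : ℕ) = n then 1 else 0
  | k + 1 => fun i => if (i : ℕ) = n then 0 else
      (∑ l, Z i l * cols a Z k l) - corr a i ⟨n - k, by omega⟩

lemma cols_spec (a : Fin n → F) {Z : Matrix (Fin (n + 1)) (Fin (n + 1)) F} (hZ : memW Z) (k : ℕ)
    (hk : k ≤ n) : (∀ i : Fin (n + 1), (i : ℕ) + k = n → cols a Z k i = 1) ∧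
      (∀ i : Fin (n + 1), (i : ℕ) + k < n → cols a Z k i = 0) := by
  induction k with
  | zero =>
    constructor
    · intro i hi; simp [cols]; omega
    · intro i hi; simp [cols]; omega
  | succ k ih =>
    obtain ⟨ih1, ih2⟩ := ih (by omega)
    have hc : ∀ i : Fin (n + 1), (i : ℕ) + (k + 1) ≤ n → corr a i ⟨n - k, by omega⟩ = 0 := by
      intro i hi
      simp only [corr]
      split_ifs <;> first | rfl | omega
    constructor
    · intro i hi
      simp only [cols]
      rw [if_neg (by omega), hc i (by omega), sub_zero,
        Finset.sum_eq_single (⟨i + 1, by omega⟩ : Fin (n + 1))]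
      · rw [(hZ _ _).1 rfl, ih1 _ (by simp; omega), one_mul]
      · intro l _ hl
        have hl' : (l : ℕ) ≠ i + 1 := fun h => hl (Fin.ext h)
        rcases lt_or_gt_of_ne hl' with h | h
        · rw [ih2 l (by omega), mul_zero]
        · rw [(hZ i l).2 h, zero_mul]
      · simp
    · intro i hi
      simp only [cols]
      rw [if_neg (by omega), hc i (by omega), sub_zero]
      refine Finset.sum_eq_zero fun l _ => ?_
      rcases lt_or_ge ((i : ℕ) + 1) (l : ℕ) with h | h
      · rw [(hZ i l).2 h, zero_mul]
      · rw [ih2 l (by omega), mul_zero]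

lemma surjOn' (hn : 1 ≤ n) (a : Fin n → F) (b : Fin (n + 1) → F)
    (Z : Matrix (Fin (n + 1)) (Fin (n + 1)) F) (hZ : memW Z) (hZ1 : ∀ j, Z (Fin.last n) j = 0)
    (hZ2 : ∀ i, Z i 0 = 0) : ∃ u : Matrix.GeneralLinearGroup (Fin n) F,
      IsLowerUni (u : Matrix (Fin n) (Fin n) F) ∧ pMap' (act u (sectSigma' a b)) = Z := by
  let u0 : Matrix (Fin n) (Fin n) F := Matrix.of fun i j => cols a Z (n - j) i.castSucc
  have hu0 : IsLowerUni u0 := by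
    constructor
    · intro i
      exact (cols_spec a hZ (n - i) (by omega)).1 _ (by have := i.2; rw [Fin.val_castSucc]; omega)
    · intro i j hij
      have hij' : (i : ℕ) < j := hij
      exact (cols_spec a hZ (n - j) (by omega)).2 _ (by have := j.2; rw [Fin.val_castSucc]; omega)
  have hdet : u0.det = 1 := by
    rw [Matrix.det_of_lowerTriangular u0 (fun i j hij => hu0.2 i j hij)]
    simp [hu0.1]
  let u : Matrix.GeneralLinearGroup (Fin n) F :=
    Matrix.GeneralLinearGroup.mkOfDetNeZero u0 (by rw [hdet]; exact one_ne_zero)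
  have huu : (u : Matrix (Fin n) (Fin n) F) = u0 := rfl
  have hu : IsLowerUni (u : Matrix (Fin n) (Fin n) F) := hu0
  have hE : ∀ i j, emb (u : Matrix (Fin n) (Fin n) F) i j = cols a Z (n - j) i := by
    intro i j
    rw [huu]
    refine Fin.lastCases ?_ (fun j => ?_) j
    · refine Fin.lastCases ?_ (fun i => ?_) i
      · rw [emb_ll]; simp [cols]
      · rw [emb_cl]; simp [cols, i.2.ne]
    · refine Fin.lastCases ?_ (fun i => ?_) i
      · rw [emb_lc]
        obtain ⟨m, hm⟩ : ∃ m, n - (j : ℕ) = m + 1 := ⟨n - j - 1, by have := j.2; omega⟩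
        simp [hm, cols]
      · rw [emb_cc]; rfl
  refine ⟨u, hu, ?_⟩
  set Z' := pMap' (act u (sectSigma' a b)) with hZ'
  have hD : ∀ i j : Fin (n + 1), (i : ℕ) < n → 1 ≤ (j : ℕ) →
      ((Z' - Z) * emb (u : Matrix (Fin n) (Fin n) F)) i j = 0 := by
    intro i j hi hj
    rw [Matrix.sub_mul, Matrix.sub_apply, hZ',
      rec_col hn a b hu i j ⟨j - 1, by omega⟩ hi (by simp; omega), hE, Matrix.mul_apply]
    have hj2 := j.2
    have e : n - ((⟨(j : ℕ) - 1, by omega⟩ : Fin (n + 1)) : ℕ) = (n - j) + 1 := by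
      simp; omega
    have e2 : (⟨n - (n - (j : ℕ)), by omega⟩ : Fin (n + 1)) = j := Fin.ext (by simp; omega)
    rw [e]
    simp only [cols, if_neg hi.ne, e2, hE]
    ring
  have hinv : emb (u : Matrix (Fin n) (Fin n) F) *
      emb ((u⁻¹ : Matrix.GeneralLinearGroup (Fin n) F) : Matrix (Fin n) (Fin n) F) = 1 := by
    rw [emb_mul, ← Units.val_mul]; simp [emb_one]
  ext i j
  by_cases hi : (i : ℕ) = n
  · have : i = Fin.last n := Fin.ext hi
    rw [this, hZ1, hZ']; simp [pMap']
  by_cases hj : (j : ℕ) = 0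
  · have : j = 0 := Fin.ext hj
    rw [this, hZ2, hZ']; simp [pMap']
  have hi' : (i : ℕ) < n := by have := i.2; omega
  have h : (Z' - Z) i j = 0 := by
    rw [← Matrix.mul_one (Z' - Z), ← hinv, ← Matrix.mul_assoc, Matrix.mul_apply]
    refine Finset.sum_eq_zero fun k _ => ?_
    by_cases hk : (k : ℕ) = 0
    · rw [(emb_lower (inv_lower hu)).2 k j (by show (k : ℕ) < j
                                               omega), mul_zero]
    · rw [hD i k hi' (by omega), zero_mul]
  exact sub_eq_zero.1 h

end helpers

/-- Lemma on `𝒲`, part 2: for fixed `(a,b)`, `u ↦ p'(u·σ'(a,b))` is a bijection from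
`N_{n,-}` onto `𝒱'`, and `u ↦ p(u·σ'(a,b))` is injective on `N_{n,-}`. -/
theorem W_bijection (n : ℕ) (hn : 1 ≤ n) (F : Type*) [Field F]
    (a : Fin n → F) (b : Fin (n + 1) → F) :
    Set.BijOn (fun u : Matrix.GeneralLinearGroup (Fin n) F => pMap' (act u (sectSigma' a b)))
      {u : Matrix.GeneralLinearGroup (Fin n) F | IsLowerUni (u : Matrix (Fin n) (Fin n) F)}
      {X : Matrix (Fin (n + 1)) (Fin (n + 1)) F |
        memW X ∧ (∀ j, X (Fin.last n) j = 0) ∧ ∀ i, X i 0 = 0} ∧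
    Set.InjOn (fun u : Matrix.GeneralLinearGroup (Fin n) F => pMap (act u (sectSigma' a b)))
      {u : Matrix.GeneralLinearGroup (Fin n) F | IsLowerUni (u : Matrix (Fin n) (Fin n) F)} := by
  have hinj := injOn' (F := F) hn a b
  refine ⟨⟨?_, hinj, ?_⟩, ?_⟩
  · intro u hu
    have hW := memW_act hn a b hu
    refine ⟨fun i j => ⟨fun hij => ?_, fun hij => ?_⟩, fun j => ?_, fun i => ?_⟩
    · have := j.2
      simp only [pMap', Matrix.of_apply]
      rw [if_neg (by omega), (hW i j).1 hij]
    · have := j.2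
      simp only [pMap', Matrix.of_apply]
      rw [if_neg (by omega), (hW i j).2 hij]
    · simp [pMap']
    · simp [pMap']
  · rintro Z ⟨h1, h2, h3⟩
    exact surjOn' hn a b Z h1 h2 h3
  · intro u hu v hv huv
    refine hinj hu hv ?_
    have hp : ∀ X : Matrix (Fin (n + 1)) (Fin (n + 1)) F, pMap' X = pMap' (pMap X) := by
      intro X
      ext i j
      simp only [pMap', pMap, Matrix.of_apply]
      split_ifs <;> first | rfl | tauto
    simp only at huv ⊢
    rw [hp, huv, ← hp]
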